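/- arXiv:2402.05772 — 8 statements merged into one kernel-verified Lean document; each statement's English description precedes it below -/
import Mathlib

section
/- Let θ : ℝ → ℝ be a differentiable function satisfying θ'(s) = 2·cos θ(s) + sin θ(s) for all s ∈ ℝ and θ(0) = 2·arctan(1/2). Then θ(s) = 2·arctan((1 + √5·tanh(√5·s/2))/2) for all s ∈ ℝ. -/
open Real

theorem Real.hasDerivAt_tanh_one_sub_sq (x : ℝ) :
    HasDerivAt Real.tanh (1 - Real.tanh x ^ 2) x := by
  have hc : Real.cosh x ≠ 0 := (Real.cosh_pos x).ne'
  have h := (Real.hasDerivAt_sinh x).div (Real.hasDerivAt_cosh x) hc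
  have he : Real.tanh = Real.sinh / Real.cosh := by
    ext y
    exact Real.tanh_eq_sinh_div_cosh y
  rw [← he] at h
  refine h.congr_deriv ?_
  rw [Real.tanh_eq_sinh_div_cosh]
  field_simp

theorem lipschitzWith_two_mul_cos_add_sin :
    LipschitzWith 3 fun x : ℝ => 2 * Real.cos x + Real.sin x := by
  refine lipschitzWith_of_nnnorm_deriv_le (by fun_prop) fun x => ?_
  have h : deriv (fun x : ℝ => 2 * Real.cos x + Real.sin x) x
      = 2 * -Real.sin x + Real.cos x :=
    (((Real.hasDerivAt_cos x).const_mul 2).add (Real.hasDerivAt_sin x)).deriv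
  rw [h, ← NNReal.coe_le_coe, coe_nnnorm, Real.norm_eq_abs, abs_le]
  have h1 := Real.neg_one_le_sin x
  have h2 := Real.sin_le_one x
  have h3 := Real.neg_one_le_cos x
  have h4 := Real.cos_le_one x
  constructor <;> push_cast <;> linarith

theorem two_mul_cos_add_sin_two_mul_arctan (u : ℝ) :
    2 * Real.cos (2 * Real.arctan u) + Real.sin (2 * Real.arctan u)
      = 2 * (1 / (1 + u ^ 2) * (1 + u - u ^ 2)) := by
  have hu : 1 + u ^ 2 ≠ 0 := by positivity
  have hs : Real.sin (Real.arctan u) = u * Real.cos (Real.arctan u) := by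
    rw [Real.sin_arctan, Real.cos_arctan]
    ring
  rw [Real.sin_two_mul, Real.cos_two_mul, hs]
  have hc := Real.cos_sq_arctan u
  calc _ = 4 * Real.cos (Real.arctan u) ^ 2 - 2 + 2 * u * Real.cos (Real.arctan u) ^ 2 := by ring
    _ = _ := by
      rw [hc]
      field_simp
      ring

theorem hasDerivAt_two_mul_arctan_tanh (s : ℝ) :
    let g := fun s : ℝ =>
      2 * Real.arctan ((1 + Real.sqrt 5 * Real.tanh (Real.sqrt 5 * s / 2)) / 2)
    HasDerivAt g (2 * Real.cos (g s) + Real.sin (g s)) s := by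
  intro g
  have h5 : Real.sqrt 5 ^ 2 = 5 := Real.sq_sqrt (by norm_num)
  have hlin : HasDerivAt (fun s : ℝ => Real.sqrt 5 * s / 2) (Real.sqrt 5 * 1 / 2) s :=
    ((hasDerivAt_id s).const_mul _).div_const 2
  have htanh := (Real.hasDerivAt_tanh_one_sub_sq (Real.sqrt 5 * s / 2)).comp s hlin
  have h := ((((htanh.const_mul (Real.sqrt 5)).const_add 1).div_const 2).arctan).const_mul 2
  refine h.congr_deriv ?_
  simp only [g, Function.comp_apply]
  rw [two_mul_cos_add_sin_two_mul_arctan]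
  congr 2
  linear_combination (1 / 4 : ℝ) * h5

/-- The solution of θ' = 2cosθ + sinθ with θ(0) = 2·arctan(1/2) is
    θ(s) = 2·arctan((1 + √5·tanh(√5 s/2))/2). -/
theorem stmt_1 (θ : ℝ → ℝ) (hθ : Differentiable ℝ θ)
    (hode : ∀ s : ℝ, deriv θ s = 2 * Real.cos (θ s) + Real.sin (θ s))
    (h0 : θ 0 = 2 * Real.arctan (1 / 2)) :
    ∀ s : ℝ,
      θ s = 2 * Real.arctan ((1 + Real.sqrt 5 * Real.tanh (Real.sqrt 5 * s / 2)) / 2) := by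
  refine congrFun (ODE_solution_unique_univ (t₀ := 0) (K := 3) (s := fun _ => Set.univ)
    (v := fun _ x => 2 * Real.cos x + Real.sin x)
    (fun _ => lipschitzWith_two_mul_cos_add_sin.lipschitzOnWith)
    (fun t => ⟨hode t ▸ (hθ t).hasDerivAt, trivial⟩)
    (fun t => ⟨hasDerivAt_two_mul_arctan_tanh t, trivial⟩) ?_)
  simp [h0]
end

section
/- Define θ(s) = 2·arctan((1 + √5·tanh(√5·s/2))/2), y(s) = (10/(√5·sinh(√5·s) + 5·cosh(√5·s)))^{1/5} · exp((4/5)·arctan((1 + √5·tanh(√5·s/2))/2)), and z(s) = (2/5)·(arctan((1 + √5·tanh(√5·s/2))/2) + log((5·cosh(√5·s) + √5·sinh(√5·s))/10)). Then for all s ∈ ℝ: y(s) > 0, y'(s) = y(s)·cos θ(s) and z'(s) = sin θ(s). -/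
open Real

/-- The half-angle `w = (1 + √5 tanh (√5 s / 2)) / 2` satisfies `w' = 1 + w - w²`. -/
lemma hasDerivAt_halfAngleTan (s : ℝ) :
    HasDerivAt (fun s : ℝ => (1 + √5 * tanh (√5 * s / 2)) / 2)
      (1 + (1 + √5 * tanh (√5 * s / 2)) / 2 - ((1 + √5 * tanh (√5 * s / 2)) / 2) ^ 2) s := by
  have h5 : √5 ^ 2 = 5 := sq_sqrt (by norm_num)
  have hu : HasDerivAt (fun s : ℝ => √5 * s / 2) (√5 / 2) s := by
    simpa using ((hasDerivAt_id s).const_mul √5).div_const 2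
  have hc : cosh (√5 * s / 2) ≠ 0 := (cosh_pos _).ne'
  have h := (((hu.sinh.div hu.cosh hc).const_mul √5).const_add 1).div_const 2
  simp only [tanh_eq_sinh_div_cosh]
  refine h.congr_deriv ?_
  field_simp
  linear_combination cosh (√5 * s / 2) ^ 2 * h5

lemma denominator_pos (x : ℝ) : 0 < √5 * sinh x + 5 * cosh x := by
  have h5 : √5 ^ 2 = 5 := sq_sqrt (by norm_num)
  have hs : 0 ≤ √5 := sqrt_nonneg 5
  have hc := cosh_pos x
  have hsum : 0 < cosh x + sinh x := by rw [cosh_add_sinh]; exact exp_pos x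
  have hlt : √5 < 5 := by nlinarith
  nlinarith [mul_nonneg hs hsum.le, mul_pos (sub_pos.2 hlt) hc]

lemma hasDerivAt_denominator (s : ℝ) :
    HasDerivAt (fun s : ℝ => √5 * sinh (√5 * s) + 5 * cosh (√5 * s))
      (5 * cosh (√5 * s) + 5 * √5 * sinh (√5 * s)) s := by
  have h5 : √5 ^ 2 = 5 := sq_sqrt (by norm_num)
  have hu : HasDerivAt (fun s : ℝ => √5 * s) √5 s := by
    simpa using (hasDerivAt_id s).const_mul √5
  refine ((hu.sinh.const_mul √5).add (hu.cosh.const_mul 5)).congr_deriv ?_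
  linear_combination cosh (√5 * s) * h5

/-- The logarithmic derivative of `√5 sinh (√5 s) + 5 cosh (√5 s)` in terms of the half-angle. -/
lemma denominator_logDeriv (s w : ℝ) (hw : w = (1 + √5 * tanh (√5 * s / 2)) / 2) :
    (5 * cosh (√5 * s) + 5 * √5 * sinh (√5 * s)) / (√5 * sinh (√5 * s) + 5 * cosh (√5 * s)) =
      (w ^ 2 + 4 * w - 1) / (1 + w ^ 2) := by
  have h5 : √5 ^ 2 = 5 := sq_sqrt (by norm_num)
  have hD := (denominator_pos (√5 * s)).ne'
  have hc : cosh (√5 * s / 2) ≠ 0 := (cosh_pos _).ne'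
  have hw' : (2 * w - 1) * cosh (√5 * s / 2) = √5 * sinh (√5 * s / 2) := by
    rw [hw, tanh_eq_sinh_div_cosh]
    field_simp
    ring
  have hx : √5 * s = 2 * (√5 * s / 2) := by ring
  have hcosh := cosh_two_mul (√5 * s / 2)
  have hsinh := sinh_two_mul (√5 * s / 2)
  rw [← hx] at hcosh hsinh
  generalize cosh (√5 * s / 2) = c at *
  generalize sinh (√5 * s / 2) = h at *
  have hh : 5 * h ^ 2 = (2 * w - 1) ^ 2 * c ^ 2 := by
    rw [← mul_pow, hw', mul_pow, h5]
  have hDen : √5 * sinh (√5 * s) + 5 * cosh (√5 * s) = 4 * c ^ 2 * (1 + w ^ 2) := by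
    rw [hcosh, hsinh]
    linear_combination (-2 * c) * hw' + hh
  have hNum : 5 * cosh (√5 * s) + 5 * √5 * sinh (√5 * s) =
      4 * c ^ 2 * (w ^ 2 + 4 * w - 1) := by
    rw [hcosh, hsinh]
    linear_combination (-10 * c) * hw' + hh
  rw [hDen, hNum, mul_div_mul_left _ _ (by positivity)]

lemma cos_two_mul_arctan_eq (w : ℝ) : cos (2 * arctan w) = (1 - w ^ 2) / (1 + w ^ 2) := by
  have hw : 1 + w ^ 2 ≠ 0 := by positivity
  rw [cos_two_mul, cos_sq_arctan]
  field_simp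
  ring

lemma sin_two_mul_arctan_eq (w : ℝ) : sin (2 * arctan w) = 2 * w / (1 + w ^ 2) := by
  have hw : 0 ≤ 1 + w ^ 2 := by positivity
  rw [sin_two_mul, sin_arctan, cos_arctan, mul_assoc, div_mul_div_comm,
    mul_self_sqrt hw, mul_one, mul_div_assoc]

/-- The explicit functions y(s), z(s) of the non-trivial parabolic v-grim reaper
    satisfy y > 0, y' = y·cos θ and z' = sin θ for the explicit angle θ(s). -/
theorem stmt_2 :
    let θ : ℝ → ℝ := fun s =>
      2 * Real.arctan ((1 + Real.sqrt 5 * Real.tanh (Real.sqrt 5 * s / 2)) / 2)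
    let y : ℝ → ℝ := fun s =>
      (10 / (Real.sqrt 5 * Real.sinh (Real.sqrt 5 * s) + 5 * Real.cosh (Real.sqrt 5 * s)))
          ^ ((1 : ℝ) / 5) *
        Real.exp ((4 / 5) *
          Real.arctan ((1 + Real.sqrt 5 * Real.tanh (Real.sqrt 5 * s / 2)) / 2))
    let z : ℝ → ℝ := fun s =>
      (2 / 5) * (Real.arctan ((1 + Real.sqrt 5 * Real.tanh (Real.sqrt 5 * s / 2)) / 2) +
        Real.log ((5 * Real.cosh (Real.sqrt 5 * s) + Real.sqrt 5 * Real.sinh (Real.sqrt 5 * s)) / 10))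
    ∀ s : ℝ, 0 < y s ∧
      HasDerivAt y (y s * Real.cos (θ s)) s ∧
      HasDerivAt z (Real.sin (θ s)) s := by
  intro θ y z s
  have hD := denominator_pos (√5 * s)
  have hA := (hasDerivAt_halfAngleTan s).arctan
  have hD' := hasDerivAt_denominator s
  have hlog := (hD'.div_const 10).log (div_pos hD (by norm_num)).ne'
  rw [div_div_div_cancel_right₀ (by norm_num : (10 : ℝ) ≠ 0),
    denominator_logDeriv s _ rfl] at hlog
  have hy : y = fun s => exp (-(1 / 5) * log ((√5 * sinh (√5 * s) + 5 * cosh (√5 * s)) / 10) +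
      4 / 5 * arctan ((1 + √5 * tanh (√5 * s / 2)) / 2)) := by
    funext r
    have hr := denominator_pos (√5 * r)
    simp only [y]
    rw [rpow_def_of_pos (by positivity), ← exp_add, ← inv_div, log_inv]
    congr 2
    ring
  have hz : z = fun s => 2 / 5 * (arctan ((1 + √5 * tanh (√5 * s / 2)) / 2) +
      log ((√5 * sinh (√5 * s) + 5 * cosh (√5 * s)) / 10)) := by
    funext r
    simp only [z]
    rw [add_comm (5 * cosh _)]
  have hw : 1 + ((1 + √5 * tanh (√5 * s / 2)) / 2) ^ 2 ≠ 0 := by positivity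
  refine ⟨?_, ?_, ?_⟩
  · rw [hy]
    exact exp_pos _
  · rw [hy]
    refine ((hlog.const_mul (-(1 / 5))).add (hA.const_mul (4 / 5))).exp.congr_deriv ?_
    simp only [θ, Pi.add_apply]
    rw [cos_two_mul_arctan_eq]
    congr 1
    generalize (1 + √5 * tanh (√5 * s / 2)) / 2 = w at *
    field_simp
    ring
  · rw [hz]
    refine ((hA.add hlog).const_mul (2 / 5)).congr_deriv ?_
    simp only [θ]
    rw [sin_two_mul_arctan_eq]
    generalize (1 + √5 * tanh (√5 * s / 2)) / 2 = w at *
    field_simp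
    ring
end

section
/- Let c₁ > 0 and c₂ ∈ ℝ. Define y(s) = c₁/cosh(s), z(s) = c₂ + 2·arctan(e^s), and θ(s) = π/2 + arctan(sinh(s)). Then for all s ∈ ℝ: y(s) > 0, y'(s) = y(s)·cos θ(s), z'(s) = sin θ(s), and θ'(s) = sin θ(s). -/
open Real

theorem Real.sqrt_one_add_sinh_sq (s : ℝ) : √(1 + Real.sinh s ^ 2) = Real.cosh s := by
  rw [add_comm, ← Real.cosh_sq, Real.sqrt_sq (Real.cosh_pos s).le]

/-- The Gudermannian angle `arctan (sinh s)` shifted by `π / 2` has sine `1 / cosh s`. -/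
theorem Real.sin_pi_div_two_add_arctan_sinh (s : ℝ) :
    Real.sin (Real.pi / 2 + Real.arctan (Real.sinh s)) = 1 / Real.cosh s := by
  rw [add_comm, Real.sin_add_pi_div_two, Real.cos_arctan, Real.sqrt_one_add_sinh_sq]

theorem Real.cos_pi_div_two_add_arctan_sinh (s : ℝ) :
    Real.cos (Real.pi / 2 + Real.arctan (Real.sinh s)) = -(Real.sinh s / Real.cosh s) := by
  rw [add_comm, Real.cos_add_pi_div_two, Real.sin_arctan, Real.sqrt_one_add_sinh_sq]

/-- The generating curve of a non-trivial parabolic minimal surface in H²×ℝ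
    solves y' = y cos θ, z' = sin θ, θ' = sin θ. -/
theorem stmt_6 (c₁ c₂ : ℝ) (hc₁ : 0 < c₁) :
    let y : ℝ → ℝ := fun s => c₁ / Real.cosh s
    let z : ℝ → ℝ := fun s => c₂ + 2 * Real.arctan (Real.exp s)
    let θ : ℝ → ℝ := fun s => Real.pi / 2 + Real.arctan (Real.sinh s)
    ∀ s : ℝ, 0 < y s ∧
      HasDerivAt y (y s * Real.cos (θ s)) s ∧
      HasDerivAt z (Real.sin (θ s)) s ∧
      HasDerivAt θ (Real.sin (θ s)) s := by
  intro y z θ s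
  have hpos := Real.cosh_pos s
  simp only [θ, Real.sin_pi_div_two_add_arctan_sinh, Real.cos_pi_div_two_add_arctan_sinh]
  refine ⟨div_pos hc₁ hpos, ?_, ?_, ?_⟩
  · refine HasDerivAt.congr_deriv ((hasDerivAt_const s c₁).div (Real.hasDerivAt_cosh s) hpos.ne') ?_
    simp only [y]
    field_simp
    ring
  · refine HasDerivAt.congr_deriv (((Real.hasDerivAt_exp s).arctan.const_mul 2).const_add c₂) ?_
    rw [Real.cosh_eq, Real.exp_neg]
    field_simp
    ring
  · refine HasDerivAt.congr_deriv ((Real.hasDerivAt_sinh s).arctan.const_add (Real.pi / 2)) ?_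
    rw [add_comm, ← Real.cosh_sq]
    field_simp
end

section
/- Let r, ρ : ℝ → ℝ be differentiable functions satisfying r'(s) = sin r(s)·cos ρ(s) and ρ'(s) = cos r(s)·sin ρ(s) for all s ∈ ℝ. Then sin r(s)·sin ρ(0) = sin r(0)·sin ρ(s) for all s ∈ ℝ; that is, the quantity sin r / sin ρ is a first integral of the system. -/
open Real

/-- A solution of a linear ODE `w' = a w` with `|a| ≤ 1` that vanishes at `0` is zero. -/
theorem eq_zero_of_hasDerivAt_mul {a w : ℝ → ℝ} (ha : ∀ s, |a s| ≤ 1)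
    (hw : ∀ s, HasDerivAt w (a s * w s) s) (h0 : w 0 = 0) (s : ℝ) : w s = 0 := by
  have hlip : ∀ t : ℝ, LipschitzOnWith 1 (fun x : ℝ => a t * x) Set.univ := fun t =>
    LipschitzOnWith.of_dist_le_mul fun x _ y _ => by
      rw [Real.dist_eq, Real.dist_eq, ← mul_sub, abs_mul]
      exact mul_le_mul_of_nonneg_right (ha t) (abs_nonneg _)
  have h := ODE_solution_unique_univ (v := fun t x => a t * x) (s := fun _ => Set.univ)
    (g := fun _ => 0) (t₀ := 0) hlip (fun t => ⟨hw t, Set.mem_univ _⟩)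
    (fun t => ⟨by simpa using hasDerivAt_const t (0 : ℝ), Set.mem_univ _⟩) h0
  exact congrFun h s

/-- Along minimal hyperbolic surfaces of H²×ℝ, sin r / sin ρ is a first integral
    of the system r' = sin r·cos ρ, ρ' = cos r·sin ρ. -/
theorem stmt_7 (r ρ : ℝ → ℝ)
    (hr : ∀ s : ℝ, HasDerivAt r (Real.sin (r s) * Real.cos (ρ s)) s)
    (hρ : ∀ s : ℝ, HasDerivAt ρ (Real.cos (r s) * Real.sin (ρ s)) s) :
    ∀ s : ℝ, Real.sin (r s) * Real.sin (ρ 0) = Real.sin (r 0) * Real.sin (ρ s) := by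
  intro s
  refine sub_eq_zero.mp (eq_zero_of_hasDerivAt_mul (a := fun t => cos (r t) * cos (ρ t))
    (w := fun t => sin (r t) * sin (ρ 0) - sin (r 0) * sin (ρ t)) (fun t => ?_) (fun t => ?_)
    (sub_self _) s)
  · rw [abs_mul]
    exact mul_le_one₀ (abs_cos_le_one _) (abs_nonneg _) (abs_cos_le_one _)
  · refine (((hr t).sin.mul_const _).sub ((hρ t).sin.const_mul _)).congr_deriv ?_
    ring
end

section
/- Let y : [0, ∞) → ℝ be a twice differentiable function with y(x) > 0 for all x ≥ 0, satisfying y''(x) = (y(x) − 2x·y'(x))·(1 + y'(x)²)/y(x)² for all x ≥ 0 and y'(0) = 0. Then y'(x) > 0 for all x > 0; in particular, x = 0 is the unique critical point of y and it is a strict global minimum. -/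
open Real

/-- A function on `[a, ∞)` that starts at a nonnegative value and has positive derivative at each
of its zeros is positive on `(a, ∞)`. -/
theorem pos_of_hasDerivAt_pos_of_eq_zero {f f' : ℝ → ℝ} {a : ℝ}
    (hf : ∀ x ∈ Set.Ici a, HasDerivAt f (f' x) x) (ha : 0 ≤ f a)
    (hzero : ∀ x ∈ Set.Ici a, f x = 0 → 0 < f' x) {x : ℝ} (hx : a < x) : 0 < f x := by
  have nonneg : ∀ z ∈ Set.Ici a, 0 ≤ f z := fun z hz =>
    image_le_of_deriv_right_lt_deriv_boundary' (f := fun _ => 0) (f' := fun _ => 0)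
      continuousOn_const (fun t _ => hasDerivWithinAt_const t _ _) ha
      (fun t ht => (hf t ht.1).continuousAt.continuousWithinAt)
      (fun t ht => (hf t ht.1).hasDerivWithinAt)
      (fun t ht h => hzero t ht.1 h.symm) ⟨hz, le_refl z⟩
  refine (nonneg x hx.le).lt_of_ne' fun h => ?_
  have hmin : IsLocalMin f x := by
    filter_upwards [Ioi_mem_nhds hx] with t ht
    exact h.trans_le (nonneg t (Set.Ioi_subset_Ici_self ht))
  exact (hzero x hx.le h).ne' (hmin.hasDerivAt_eq_zero (hf x hx.le))

/-- For the vertical h-grim reaper ODE y'' = (y − 2x y')(1 + y'²)/y² on [0,∞)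
    with y'(0) = 0, the derivative is positive for x > 0, so x = 0 is the unique
    critical point and a strict global minimum. -/
theorem stmt_11 (y y' y'' : ℝ → ℝ)
    (hy : ∀ x ∈ Set.Ici (0 : ℝ), HasDerivAt y (y' x) x)
    (hy' : ∀ x ∈ Set.Ici (0 : ℝ), HasDerivAt y' (y'' x) x)
    (hpos : ∀ x ∈ Set.Ici (0 : ℝ), 0 < y x)
    (hode : ∀ x ∈ Set.Ici (0 : ℝ),
      y'' x = (y x - 2 * x * y' x) * (1 + (y' x) ^ 2) / (y x) ^ 2)
    (h0 : y' 0 = 0) :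
    (∀ x : ℝ, 0 < x → 0 < y' x) ∧
    (∀ x ∈ Set.Ici (0 : ℝ), y' x = 0 → x = 0) ∧
    (∀ x : ℝ, 0 < x → y 0 < y x) := by
  have hder : ∀ x : ℝ, 0 < x → 0 < y' x := fun x hx =>
    pos_of_hasDerivAt_pos_of_eq_zero hy' h0.ge (fun t ht h => by
      have := hpos t ht
      rw [hode t ht, h]
      simp only [mul_zero, sub_zero]
      positivity) hx
  refine ⟨hder, fun x hx h => ?_, fun x hx => ?_⟩
  · by_contra hne
    exact (hder x (lt_of_le_of_ne hx (Ne.symm hne))).ne' h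
  · exact strictMonoOn_of_hasDerivWithinAt_pos (f' := y') (convex_Ici 0)
      (fun t ht => (hy t ht).continuousAt.continuousWithinAt)
      (fun t ht => (hy t (interior_subset ht)).hasDerivWithinAt)
      (fun t ht => hder t (by simpa using ht)) Set.self_mem_Ici hx.le hx
end

section
/- Let y : [0, ∞) → ℝ be a twice differentiable function with y(x) > 0 for all x ≥ 0, satisfying y''(x) = (y(x) − 2x·y'(x))·(1 + y'(x)²)/y(x)² for all x ≥ 0 and y'(0) = 0. Then there exists x₀ > 0 such that y''(x₀) = 0; that is, y cannot be strictly convex on all of (0, ∞) and changes its curvature at some point. -/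
open Real

/-- For the vertical h-grim reaper ODE y'' = (y − 2x y')(1 + y'²)/y² on [0,∞)
    with y'(0) = 0, the second derivative vanishes somewhere: the graph changes
    its curvature. -/
theorem stmt_12 (y y' y'' : ℝ → ℝ)
    (hy : ∀ x ∈ Set.Ici (0 : ℝ), HasDerivAt y (y' x) x)
    (hy' : ∀ x ∈ Set.Ici (0 : ℝ), HasDerivAt y' (y'' x) x)
    (hpos : ∀ x ∈ Set.Ici (0 : ℝ), 0 < y x)
    (hode : ∀ x ∈ Set.Ici (0 : ℝ),
      y'' x = (y x - 2 * x * y' x) * (1 + (y' x) ^ 2) / (y x) ^ 2)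
    (h0 : y' 0 = 0) :
    ∃ x₀ : ℝ, 0 < x₀ ∧ y'' x₀ = 0 := by
  by_contra! hne
  have hcy : ContinuousOn y (Set.Ici 0) := fun x hx => (hy x hx).continuousAt.continuousWithinAt
  have hcy' : ContinuousOn y' (Set.Ici 0) :=
    fun x hx => (hy' x hx).continuousAt.continuousWithinAt
  have hfpos : ∀ x ∈ Set.Ici (0 : ℝ), 0 < y x - 2 * x * y' x := by
    intro x hx
    by_contra! hle
    have hcont : ContinuousOn (fun t => y t - 2 * t * y' t) (Set.Icc 0 x) :=
      (hcy.sub ((continuousOn_const.mul continuousOn_id).mul hcy')).mono Set.Icc_subset_Ici_self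
    have hzero : (0 : ℝ) ∈ Set.Icc (y x - 2 * x * y' x) (y 0 - 2 * 0 * y' 0) :=
      ⟨hle, by simpa using (hpos 0 Set.self_mem_Ici).le⟩
    obtain ⟨c, hc, hfc⟩ := intermediate_value_Icc' hx hcont hzero
    have hfc' : y c - 2 * c * y' c = 0 := hfc
    have hc0 : c ≠ 0 := by
      rintro rfl
      have := hpos 0 Set.self_mem_Ici
      simp at hfc'
      linarith
    exact hne c (lt_of_le_of_ne hc.1 hc0.symm) (by rw [hode c hc.1, hfc']; simp)
  have hypp : ∀ x ∈ Set.Ici (0 : ℝ), 0 < y'' x := by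
    intro x hx
    rw [hode x hx]
    have := hfpos x hx
    have := hpos x hx
    positivity
  have hmono : StrictMonoOn y' (Set.Ici 0) := by
    refine strictMonoOn_of_deriv_pos (convex_Ici 0) hcy' fun x hx => ?_
    have hx' := interior_subset hx
    rw [(hy' x hx').deriv]
    exact hypp x hx'
  have hanti : AntitoneOn (fun t => y t - t * y' t) (Set.Ici 0) := by
    refine antitoneOn_of_deriv_nonpos (convex_Ici 0) (hcy.sub (continuousOn_id.mul hcy'))
      (fun x hx => ?_) fun x hx => ?_
    all_goals
      have hx' : x ∈ Set.Ici (0 : ℝ) := interior_subset hx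
      have hd := (hy x hx').sub ((hasDerivAt_id x).mul (hy' x hx'))
    · exact hd.differentiableAt.differentiableWithinAt
    · have hderiv : deriv (fun t => y t - t * y' t) x = y' x - (1 * y' x + x * y'' x) := hd.deriv
      rw [hderiv]
      have := mul_nonneg (Set.mem_Ici.1 hx') (hypp x hx').le
      linarith
  -- The intercept of the tangent line decreases, yet it would exceed every bound.
  have hp : 0 < y' 1 := h0 ▸ hmono Set.self_mem_Ici (Set.mem_Ici.2 zero_le_one) one_pos
  have hy0 := hpos 0 Set.self_mem_Ici
  set X := y 0 / y' 1 + 1 with hX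
  have hX1 : 1 ≤ X := by
    have := div_pos hy0 hp
    linarith
  have hX0 : X ∈ Set.Ici (0 : ℝ) := Set.mem_Ici.2 (by linarith)
  have hle : y' 1 ≤ y' X := hmono.monotoneOn (Set.mem_Ici.2 zero_le_one) hX0 hX1
  have hXp : X * y' 1 = y 0 + y' 1 := by rw [hX]; field_simp
  have hg : y X - X * y' X ≤ y 0 - 0 * y' 0 := hanti Set.self_mem_Ici hX0 hX0
  have hf := hfpos X hX0
  have := mul_le_mul_of_nonneg_left hle (Set.mem_Ici.1 hX0)
  linarith
end

section
/- Let y, θ : ℝ → ℝ be differentiable functions with y(s) > 0 for all s, satisfying y'(s) = y(s)·sin θ(s) and θ'(s) = cos θ(s)·(2 − y(s))/y(s) for all s ∈ ℝ. Then the function s ↦ cos θ(s)·e^{−2/y(s)}/y(s) is constant on ℝ; that is, cos θ = c·y·e^{2/y} for some constant c, giving a first integral of the system. -/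
open Real

/-- First integral of the vertical c₊-grim reaper system
    y' = y sin θ, θ' = cos θ·(2 − y)/y: the quantity cos θ·e^{−2/y}/y is constant,
    i.e. cos θ = c·y·e^{2/y}. -/
theorem stmt_16 (y θ : ℝ → ℝ) (hpos : ∀ s : ℝ, 0 < y s)
    (hy : ∀ s : ℝ, HasDerivAt y (y s * Real.sin (θ s)) s)
    (hθ : ∀ s : ℝ, HasDerivAt θ (Real.cos (θ s) * (2 - y s) / y s) s) :
    ∀ s : ℝ,
      Real.cos (θ s) * Real.exp (-2 / y s) / y s =
        Real.cos (θ 0) * Real.exp (-2 / y 0) / y 0 := by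
  have hderiv : ∀ s : ℝ,
      HasDerivAt (fun t => Real.cos (θ t) * Real.exp (-2 / y t) / y t) 0 s := by
    intro s
    have hne : y s ≠ 0 := (hpos s).ne'
    have hexp := ((hasDerivAt_const s (-2 : ℝ)).fun_div (hy s) hne).exp
    refine (((hθ s).cos.fun_mul hexp).fun_div (hy s) hne).congr_deriv ?_
    field_simp
    ring
  intro s
  exact is_const_of_deriv_eq_zero (fun t => (hderiv t).differentiableAt)
    (fun t => (hderiv t).deriv) s 0
end

section
/- Let y, θ : ℝ → ℝ be differentiable functions with y(s) > 0 for all s, satisfying y'(s) = y(s)·sin θ(s) and θ'(s) = cos θ(s)·(y(s) − 2)/y(s) for all s ∈ ℝ. Then the function s ↦ cos θ(s)·y(s)·e^{2/y(s)} is constant on ℝ, giving a first integral of the system. -/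
open Real

/-- First integral of the vertical c₋-grim reaper system
    y' = y sin θ, θ' = cos θ·(y − 2)/y: the quantity cos θ·y·e^{2/y} is constant. -/
theorem stmt_17 (y θ : ℝ → ℝ) (hpos : ∀ s : ℝ, 0 < y s)
    (hy : ∀ s : ℝ, HasDerivAt y (y s * Real.sin (θ s)) s)
    (hθ : ∀ s : ℝ, HasDerivAt θ (Real.cos (θ s) * (y s - 2) / y s) s) :
    ∀ s : ℝ,
      Real.cos (θ s) * y s * Real.exp (2 / y s) =
        Real.cos (θ 0) * y 0 * Real.exp (2 / y 0) := by
  have hderiv : ∀ s : ℝ,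
      HasDerivAt (fun t => Real.cos (θ t) * y t * Real.exp (2 / y t)) 0 s := by
    intro s
    have hne : y s ≠ 0 := (hpos s).ne'
    have h := ((hθ s).cos.mul (hy s)).mul (((hasDerivAt_const s (2 : ℝ)).div (hy s) hne).exp)
    refine h.congr_deriv ?_
    simp only [Pi.mul_apply, Pi.div_apply]
    field_simp
    ring
  intro s
  exact is_const_of_deriv_eq_zero (fun t => (hderiv t).differentiableAt)
    (fun t => (hderiv t).deriv) s 0
end
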